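/- Generation for abstractions: suppose λx^L.M : ⟨Γ ⊢ U⟩ with d(U) = K in the indexed intersection type system with expansion variables. Then either U = ω^K, or U = ⊓_{i=1}^p e⃗_K (V_i → T_i) with p ≥ 1 and: if x^L ∈ fv(M), then for all i ∈ {1,…,p}, M : ⟨Γ, x^L : e⃗_K V_i ⊢ e⃗_K T_i⟩; if x^L ∉ fv(M), then for all i ∈ {1,…,p}, M : ⟨Γ ⊢ e⃗_K T_i⟩. -/

import Mathlib

/-! # The indexed λ-calculus with expansion variables
(Kamareddine, Nour, Rahli, Wells) -/

/-- Indexed variables: a variable name together with an index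
(a finite sequence of natural numbers). -/
abbrev IVar := ℕ × List ℕ

/-- Raw terms of the indexed λ-calculus. -/
inductive Trm : Type
  | var : ℕ → List ℕ → Trm
  | app : Trm → Trm → Trm
  | lam : ℕ → List ℕ → Trm → Trm
  deriving DecidableEq

namespace Trm

/-- Free (indexed) variables of a term. -/
def fv : Trm → Finset IVar
  | var x L => {(x, L)}
  | app M N => fv M ∪ fv N
  | lam x L M => fv M \ {(x, L)}

/-- Degree of a term. -/
def deg : Trm → List ℕ
  | var _ L => L
  | app M _ => deg M
  | lam _ _ M => deg M

/-- `M ◇ N` : the terms `M` and `N` are joinable. -/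
def Joinable (M N : Trm) : Prop :=
  ∀ x L K, (x, L) ∈ fv M → (x, K) ∈ fv N → L = K

/-- Well-formed terms (membership in the set 𝓜). -/
inductive Wf : Trm → Prop
  | var (x : ℕ) (L : List ℕ) : Wf (var x L)
  | app {M N : Trm} : Wf M → Wf N → deg M <+: deg N → Joinable M N → Wf (app M N)
  | lam {M : Trm} (x : ℕ) (L : List ℕ) : Wf M → deg M <+: L → Wf (lam x L M)

/-- Substitution `M[x^L := N]`. -/
def subst (M : Trm) (x : ℕ) (L : List ℕ) (N : Trm) : Trm :=
  match M with
  | var y K => if (y, K) = (x, L) then N else var y K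
  | app P Q => app (subst P x L N) (subst Q x L N)
  | lam y K P => if (y, K) = (x, L) then lam y K P else lam y K (subst P x L N)

/-- Simultaneous substitution `M[(x_j^{L_j} := N_j)_n]`. -/
def msubst : List (IVar × Trm) → Trm → Trm
  | σ, var y K =>
      match σ.find? (fun e => decide (e.1 = (y, K))) with
      | some e => e.2
      | none => var y K
  | σ, app M N => app (msubst σ M) (msubst σ N)
  | σ, lam y K M => lam y K (msubst (σ.filter fun e => decide (e.1 ≠ (y, K))) M)

/-- `M^{+i}` : prepend `i` to every index occurring in `M`. -/
def lift (i : ℕ) : Trm → Trm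
  | var x L => var x (i :: L)
  | app M N => app (lift i M) (lift i N)
  | lam x L M => lam x (i :: L) (lift i M)

/-- One step of `M^{-i}` (meaningful when every index of `M` starts with `i`). -/
def lower : Trm → Trm
  | var x L => var x L.tail
  | app M N => app (lower M) (lower N)
  | lam x L M => lam x L.tail (lower M)

/-- `M^{-K}`. -/
def lowerSeq (K : List ℕ) (M : Trm) : Trm := K.foldl (fun M _ => lower M) M

end Trm

open Trm

/-- Base β-redexes. -/
inductive BetaBase : Trm → Trm → Prop
  | redex {x : ℕ} {L : List ℕ} {M N : Trm} :
      Wf (.app (.lam x L M) N) → deg N = L →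
      BetaBase (.app (.lam x L M) N) (Trm.subst M x L N)

/-- Base η-redexes. -/
inductive EtaBase : Trm → Trm → Prop
  | redex {x : ℕ} {L : List ℕ} {M : Trm} :
      Wf (.lam x L (.app M (.var x L))) → (x, L) ∉ fv M →
      EtaBase (.lam x L (.app M (.var x L))) M

/-- Compatible closure of a relation, on well-formed terms. -/
inductive Compat (R : Trm → Trm → Prop) : Trm → Trm → Prop
  | base {M N : Trm} : R M N → Compat R M N
  | lam {x : ℕ} {L : List ℕ} {M N : Trm} :
      Compat R M N → Wf (.lam x L M) → Wf (.lam x L N) →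
      Compat R (.lam x L M) (.lam x L N)
  | appL {M N P : Trm} :
      Compat R M N → Wf (.app M P) → Wf (.app N P) →
      Compat R (.app M P) (.app N P)
  | appR {M N P : Trm} :
      Compat R M N → Wf (.app P M) → Wf (.app P N) →
      Compat R (.app P M) (.app P N)

/-- One-step β-reduction `▷_β`. -/
def BetaRed : Trm → Trm → Prop := Compat BetaBase

/-- One-step η-reduction `▷_η`. -/
def EtaRed : Trm → Trm → Prop := Compat EtaBase

/-- One-step βη-reduction `▷_βη = ▷_β ∪ ▷_η`. -/
def BetaEtaRed (M N : Trm) : Prop := BetaRed M N ∨ EtaRed M N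

/-- Weak head reduction `▷_h`. -/
inductive HRed : Trm → Trm → Prop
  | head {x : ℕ} {L : List ℕ} {M N : Trm} :
      Wf (.app (.lam x L M) N) → deg N = L →
      HRed (.app (.lam x L M) N) (Trm.subst M x L N)
  | app {M M' P : Trm} :
      HRed M M' → Wf (.app M P) → Wf (.app M' P) →
      HRed (.app M P) (.app M' P)

/-- `▷*_r` : reflexive transitive closure of a reduction. -/
def RedStar (R : Trm → Trm → Prop) : Trm → Trm → Prop := Relation.ReflTransGen R

/-- `≃_r` : the equivalence relation induced by `▷*_r`. -/
inductive RedConv (R : Trm → Trm → Prop) : Trm → Trm → Prop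
  | rel {M N : Trm} : RedStar R M N → RedConv R M N
  | symm {M N : Trm} : RedConv R M N → RedConv R N M
  | trans {M N P : Trm} : RedConv R M N → RedConv R N P → RedConv R M P

/-- `r ∈ {β, βη, h}`. -/
def IsRed (R : Trm → Trm → Prop) : Prop :=
  R = BetaRed ∨ R = BetaEtaRed ∨ R = HRed

/-! ## Types -/

/-- Raw types. -/
inductive PreTy : Type
  | atom : ℕ → PreTy
  | arrow : PreTy → PreTy → PreTy
  | omega : List ℕ → PreTy
  | inter : PreTy → PreTy → PreTy
  | exp : ℕ → PreTy → PreTy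
  deriving DecidableEq

/-- Degree of a type. -/
def tdeg : PreTy → List ℕ
  | .atom _ => []
  | .arrow _ _ => []
  | .omega L => L
  | .inter U _ => tdeg U
  | .exp i U => i :: tdeg U

mutual
  /-- The set 𝕋 of types. -/
  inductive TyT : PreTy → Prop
    | atom (a : ℕ) : TyT (.atom a)
    | arrow {U T : PreTy} : TyU U → TyT T → TyT (.arrow U T)
  /-- The set 𝕌 of types. -/
  inductive TyU : PreTy → Prop
    | ofT {T : PreTy} : TyT T → TyU T
    | omega (L : List ℕ) : TyU (.omega L)
    | inter {U V : PreTy} : TyU U → TyU V → tdeg U = tdeg V → TyU (.inter U V)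
    | exp (i : ℕ) {U : PreTy} : TyU U → TyU (.exp i U)
end

/-- Equality of types modulo the identifications of the paper
(⊓ commutative, associative, idempotent; expansion variables distribute
over ⊓; ω neutral; ē_i ω^K = ω^{i::K}). -/
inductive TyEq : PreTy → PreTy → Prop
  | refl (U : PreTy) : TyEq U U
  | symm {U V : PreTy} : TyEq U V → TyEq V U
  | trans {U V W : PreTy} : TyEq U V → TyEq V W → TyEq U W
  | arrowCongr {U U' T T' : PreTy} :
      TyEq U U' → TyEq T T' → TyEq (.arrow U T) (.arrow U' T')
  | interCongr {U U' V V' : PreTy} :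
      TyEq U U' → TyEq V V' → TyEq (.inter U V) (.inter U' V')
  | expCongr (i : ℕ) {U U' : PreTy} : TyEq U U' → TyEq (.exp i U) (.exp i U')
  | interComm (U V : PreTy) : TyEq (.inter U V) (.inter V U)
  | interAssoc (U V W : PreTy) :
      TyEq (.inter U (.inter V W)) (.inter (.inter U V) W)
  | interIdem (U : PreTy) : TyEq (.inter U U) U
  | expDist (i : ℕ) (U V : PreTy) :
      TyEq (.exp i (.inter U V)) (.inter (.exp i U) (.exp i V))
  | omegaNeutral {L : List ℕ} {U : PreTy} :
      tdeg U = L → TyEq (.inter (.omega L) U) U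
  | expOmega (i : ℕ) (K : List ℕ) : TyEq (.exp i (.omega K)) (.omega (i :: K))

/-- `e⃗_K U`. -/
def expSeq : List ℕ → PreTy → PreTy
  | [], U => U
  | i :: K, U => .exp i (expSeq K U)

/-- Intersection of a list of types (meaningful for nonempty lists). -/
def interAll : List PreTy → PreTy
  | [] => .omega []
  | T :: Ts => Ts.foldl PreTy.inter T

/-- One step of `U^{-i}` (meaningful when `tdeg U` starts with `i`). -/
def tlower : PreTy → PreTy
  | .exp _ U => U
  | .inter U V => .inter (tlower U) (tlower V)
  | .omega L => .omega L.tail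
  | U => U

/-- `U^{-K}`. -/
def tlowerSeq (K : List ℕ) (U : PreTy) : PreTy := K.foldl (fun U _ => tlower U) U

/-- Subtyping `⊑` on types (reflexivity holds up to the identifications `TyEq`). -/
inductive TySub : PreTy → PreTy → Prop
  | ofEq {U V : PreTy} : TyEq U V → TySub U V
  | trans {U V W : PreTy} : TySub U V → TySub V W → TySub U W
  | interLeft {U V : PreTy} : tdeg U = tdeg V → TySub (.inter U V) U
  | inter {U₁ U₂ V₁ V₂ : PreTy} :
      TySub U₁ V₁ → TySub U₂ V₂ → TySub (.inter U₁ U₂) (.inter V₁ V₂)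
  | arrow {U₁ U₂ T₁ T₂ : PreTy} :
      TySub U₂ U₁ → TySub T₁ T₂ → TySub (.arrow U₁ T₁) (.arrow U₂ T₂)
  | exp (i : ℕ) {U V : PreTy} : TySub U V → TySub (.exp i U) (.exp i V)

/-! ## Type environments -/

/-- Type environments: finite-ish assignments of types to indexed variables. -/
def TyEnv : Type := IVar → Option PreTy

namespace TyEnv

/-- The empty environment `()`. -/
def empty : TyEnv := fun _ => none

/-- Singleton environment `(x^L : U)`. -/
def single (v : IVar) (U : PreTy) : TyEnv := fun w => if w = v then some U else none

/-- `Γ, (x^L : U)`. -/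
def extend (Γ : TyEnv) (v : IVar) (U : PreTy) : TyEnv :=
  fun w => if w = v then some U else Γ w

/-- `Γ₁ ⊓ Γ₂`. -/
def inter (Γ₁ Γ₂ : TyEnv) : TyEnv := fun v =>
  match Γ₁ v, Γ₂ v with
  | some U, some V => some (PreTy.inter U V)
  | some U, none => some U
  | none, o => o

/-- `ē_j Γ`. -/
def expand (j : ℕ) (Γ : TyEnv) : TyEnv := fun v =>
  match v.2 with
  | [] => none
  | i :: L => if i = j then (Γ (v.1, L)).map (PreTy.exp j) else none

/-- `env^ω_M`. -/
def omegaOf (M : Trm) : TyEnv :=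
  fun v => if v ∈ Trm.fv M then some (PreTy.omega v.2) else none

/-- `Γ` is OK: `d(U) = L` for every `x^L : U ∈ Γ`. -/
def OK (Γ : TyEnv) : Prop := ∀ x L U, Γ (x, L) = some U → tdeg U = L

/-- `Γ₁ ◇ Γ₂`. -/
def Diamond (Γ₁ Γ₂ : TyEnv) : Prop :=
  ∀ x L K, Γ₁ (x, L) ≠ none → Γ₂ (x, K) ≠ none → L = K

/-- `Γ ⊑ Γ'` : same domain and pointwise subtyping. -/
def Sub (Γ Γ' : TyEnv) : Prop :=
  (∀ v, Γ v = none ↔ Γ' v = none) ∧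
  ∀ v U U', Γ v = some U → Γ' v = some U' → TySub U U'

/-- `d(Γ) ⪰ L`. -/
def DegGe (Γ : TyEnv) (L : List ℕ) : Prop :=
  ∀ x K U, Γ (x, K) = some U → L <+: tdeg U ∧ L <+: K

/-- One step of `Γ^{-i}`. -/
def lower (i : ℕ) (Γ : TyEnv) : TyEnv := fun v => (Γ (v.1, i :: v.2)).map tlower

/-- `Γ^{-K}`. -/
def lowerSeq (K : List ℕ) (Γ : TyEnv) : TyEnv :=
  K.foldl (fun Γ i => lower i Γ) Γ

/-- `Γ↾_S` : restriction of `Γ` to the variables in `S`. -/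
def restrict (Γ : TyEnv) (S : Finset IVar) : TyEnv :=
  fun v => if v ∈ S then Γ v else none

/-- `Γ↑^S` : extend `Γ` by `ω`-types on the variables of `S` not in `dom Γ`. -/
def up (Γ : TyEnv) (S : Finset IVar) : TyEnv := fun v =>
  match Γ v with
  | some U => some U
  | none => if v ∈ S then some (PreTy.omega v.2) else none

end TyEnv

/-! ## The typing relation -/

/-- The typing relation `M : ⟨Γ ⊢ U⟩`. -/
inductive Typ : Trm → TyEnv → PreTy → Prop
  | ax {x : ℕ} {T : PreTy} :
      TyT T → Typ (.var x []) (TyEnv.single (x, []) T) T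
  | omegaI {M : Trm} :
      Wf M → Typ M (TyEnv.omegaOf M) (.omega (Trm.deg M))
  | arrI {M : Trm} {Γ : TyEnv} {x : ℕ} {L : List ℕ} {U T : PreTy} :
      Γ (x, L) = none → TyU U → TyT T →
      Typ M (Γ.extend (x, L) U) T →
      Typ (.lam x L M) Γ (.arrow U T)
  | arrI' {M : Trm} {Γ : TyEnv} {x : ℕ} {L : List ℕ} {T : PreTy} :
      Γ (x, L) = none → TyT T →
      Typ M Γ T →
      Typ (.lam x L M) Γ (.arrow (.omega L) T)
  | arrE {M₁ M₂ : Trm} {Γ₁ Γ₂ : TyEnv} {U T : PreTy} :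
      TyU U → TyT T →
      Typ M₁ Γ₁ (.arrow U T) → Typ M₂ Γ₂ U → TyEnv.Diamond Γ₁ Γ₂ →
      Typ (.app M₁ M₂) (Γ₁.inter Γ₂) T
  | interI {M : Trm} {Γ : TyEnv} {U₁ U₂ : PreTy} :
      Typ M Γ U₁ → Typ M Γ U₂ → Typ M Γ (.inter U₁ U₂)
  | expI {M : Trm} {Γ : TyEnv} {U : PreTy} (j : ℕ) :
      Typ M Γ U → Typ (Trm.lift j M) (TyEnv.expand j Γ) (.exp j U)
  | sub {M : Trm} {Γ Γ' : TyEnv} {U U' : PreTy} :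
      Typ M Γ U → TyEnv.Sub Γ' Γ → TySub U U' → Typ M Γ' U'

/-! ## Realisability semantics -/

/-- `X^{+i}`. -/
def liftSet (i : ℕ) (X : Set Trm) : Set Trm := Trm.lift i '' X

/-- `X ⇝ Y`. -/
def arrowSet (X Y : Set Trm) : Set Trm :=
  {M | ∀ N ∈ X, Joinable M N → Trm.app M N ∈ Y}

/-- `X` is `r`-saturated. -/
def RSaturated (R : Trm → Trm → Prop) (X : Set Trm) : Prop :=
  ∀ M N, RedStar R M N → N ∈ X → M ∈ X

/-- `𝓜^L` : well-formed terms of degree `L`. -/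
def TrmDeg (L : List ℕ) : Set Trm := {M | Wf M ∧ Trm.deg M = L}

/-- The set of variables `𝓥₁` (its complement is `𝓥₂`). -/
def V1 : Set ℕ := {n | Even n}

/-- Spines `x^L N₁ … N_k`. -/
inductive Spine (x : ℕ) (L : List ℕ) : Trm → Prop
  | var : Spine x L (.var x L)
  | app {M N : Trm} : Spine x L M → Spine x L (.app M N)

/-- `𝓝_x^L`. -/
def Nx (x : ℕ) (L : List ℕ) : Set Trm := {M | Wf M ∧ Spine x L M}

/-- `I` is an `r`-interpretation. -/
structure IsInterp (R : Trm → Trm → Prop) (I : ℕ → Set Trm) : Prop where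
  sat : ∀ a, RSaturated R (I a)
  sub : ∀ a, I a ⊆ TrmDeg []
  nx : ∀ a, ∀ x ∈ V1, Nx x [] ⊆ I a

/-- Extension of an interpretation to all types. -/
def interp (I : ℕ → Set Trm) : PreTy → Set Trm
  | .atom a => I a
  | .omega L => TrmDeg L
  | .inter U V => interp I U ∩ interp I V
  | .exp i U => liftSet i (interp I U)
  | .arrow U T => arrowSet (interp I U) (interp I T)

/-- `[U]_r` : the meaning of the type `U`. -/
def Sem (R : Trm → Trm → Prop) (U : PreTy) : Set Trm :=
  {M | Wf M ∧ Trm.fv M = ∅ ∧ ∀ I, IsInterp R I → M ∈ interp I U}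

/-- The components of a type: its atoms and arrows outside arrows, each with the sequence of
expansion variables above it. -/
def PreTy.comps : PreTy → List (List ℕ × PreTy)
  | .atom a => [([], .atom a)]
  | .arrow U T => [([], .arrow U T)]
  | .omega _ => []
  | .inter U V => U.comps ++ V.comps
  | .exp i U => U.comps.map fun c => (i :: c.1, c.2)

/-- Intersections outside arrows are between types of equal degree. -/
def PreTy.Homogeneous : PreTy → Prop
  | .atom _ => True
  | .arrow _ _ => True
  | .omega _ => True
  | .inter U V => U.Homogeneous ∧ V.Homogeneous ∧ tdeg U = tdeg V
  | .exp _ U => U.Homogeneous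

/-- Subtyping between components. -/
inductive CompSub : List ℕ × PreTy → List ℕ × PreTy → Prop
  | atom (K : List ℕ) (a : ℕ) : CompSub (K, .atom a) (K, .atom a)
  | arrow (K : List ℕ) {U U' T T' : PreTy} :
      TySub U' U → TySub T T' → CompSub (K, .arrow U T) (K, .arrow U' T')

theorem CompSub.trans {a b c : List ℕ × PreTy} (h₁ : CompSub a b) (h₂ : CompSub b c) :
    CompSub a c := by
  cases h₁ with
  | atom => exact h₂
  | arrow K hU hT =>
    cases h₂ with
    | arrow _ hU' hT' => exact .arrow K (hU'.trans hU) (hT.trans hT')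

theorem CompSub.cons (i : ℕ) {a b : List ℕ × PreTy} (h : CompSub a b) :
    CompSub (i :: a.1, a.2) (i :: b.1, b.2) := by
  cases h with
  | atom K a => exact .atom _ a
  | arrow K hU hT => exact .arrow _ hU hT

theorem PreTy.compSub_refl {U : PreTy} : ∀ c ∈ U.comps, CompSub c c := by
  induction U with
  | atom a => simpa [comps] using CompSub.atom [] a
  | arrow U T => simpa [comps] using CompSub.arrow [] (.ofEq (.refl U)) (.ofEq (.refl T))
  | omega => simp [comps]
  | inter U V hU hV =>
    intro c hc
    rcases List.mem_append.1 hc with hc | hc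
    exacts [hU c hc, hV c hc]
  | exp i U hU =>
    intro c hc
    obtain ⟨d, hd, rfl⟩ := List.mem_map.1 hc
    exact (hU d hd).cons i

/-- Every component in the second list is above one in the first. -/
def CompsSub (l l' : List (List ℕ × PreTy)) : Prop := ∀ c ∈ l', ∃ d ∈ l, CompSub d c

namespace CompsSub

variable {l l₁ l₂ l₃ l₁' l₂' : List (List ℕ × PreTy)}

theorem trans (h₁ : CompsSub l₁ l₂) (h₂ : CompsSub l₂ l₃) : CompsSub l₁ l₃ := by
  intro c hc
  obtain ⟨d, hd, hdc⟩ := h₂ c hc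
  obtain ⟨e, he, hed⟩ := h₁ d hd
  exact ⟨e, he, hed.trans hdc⟩

theorem of_subset {U : PreTy} (h : U.comps ⊆ l) : CompsSub l U.comps :=
  fun c hc => ⟨c, h hc, PreTy.compSub_refl c hc⟩

theorem append (h₁ : CompsSub l₁ l₁') (h₂ : CompsSub l₂ l₂') :
    CompsSub (l₁ ++ l₂) (l₁' ++ l₂') := by
  intro c hc
  rcases List.mem_append.1 hc with hc | hc
  · obtain ⟨d, hd, hdc⟩ := h₁ c hc
    exact ⟨d, List.mem_append_left _ hd, hdc⟩
  · obtain ⟨d, hd, hdc⟩ := h₂ c hc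
    exact ⟨d, List.mem_append_right _ hd, hdc⟩

theorem map_cons (i : ℕ) (h : CompsSub l₁ l₂) :
    CompsSub (l₁.map fun c => (i :: c.1, c.2)) (l₂.map fun c => (i :: c.1, c.2)) := by
  intro c hc
  obtain ⟨d, hd, rfl⟩ := List.mem_map.1 hc
  obtain ⟨e, he, hed⟩ := h d hd
  exact ⟨_, List.mem_map_of_mem he, hed.cons i⟩

theorem arrow {U U' T T' : PreTy} (hU : TySub U' U) (hT : TySub T T') :
    CompsSub (PreTy.arrow U T).comps (PreTy.arrow U' T').comps := by
  simpa [CompsSub, PreTy.comps] using CompSub.arrow [] hU hT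

end CompsSub

theorem TyEq.compsSub {U V : PreTy} (h : TyEq U V) :
    CompsSub U.comps V.comps ∧ CompsSub V.comps U.comps := by
  have of_subsets {U V : PreTy} (h : V.comps ⊆ U.comps) (h' : U.comps ⊆ V.comps) :
      CompsSub U.comps V.comps ∧ CompsSub V.comps U.comps := ⟨.of_subset h, .of_subset h'⟩
  induction h with
  | refl U => exact of_subsets (by simp) (by simp)
  | symm _ ih => exact ih.symm
  | trans _ _ ih₁ ih₂ => exact ⟨ih₁.1.trans ih₂.1, ih₂.2.trans ih₁.2⟩
  | arrowCongr hU hT =>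
    exact ⟨.arrow (.ofEq hU.symm) (.ofEq hT), .arrow (.ofEq hU) (.ofEq hT.symm)⟩
  | interCongr _ _ ih₁ ih₂ => exact ⟨ih₁.1.append ih₂.1, ih₁.2.append ih₂.2⟩
  | expCongr i _ ih => exact ⟨ih.1.map_cons i, ih.2.map_cons i⟩
  | interComm => exact of_subsets (by simp [PreTy.comps]) (by simp [PreTy.comps])
  | interAssoc => exact of_subsets (by simp [PreTy.comps]) (by simp [PreTy.comps])
  | interIdem => exact of_subsets (by simp [PreTy.comps]) (by simp [PreTy.comps])
  | expDist => exact of_subsets (by simp [PreTy.comps]) (by simp [PreTy.comps])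
  | omegaNeutral => exact of_subsets (by simp [PreTy.comps]) (by simp [PreTy.comps])
  | expOmega => exact of_subsets (by simp [PreTy.comps]) (by simp [PreTy.comps])

theorem TySub.compsSub {U V : PreTy} (h : TySub U V) : CompsSub U.comps V.comps := by
  induction h with
  | ofEq h => exact h.compsSub.1
  | trans _ _ ih₁ ih₂ => exact ih₁.trans ih₂
  | interLeft => exact .of_subset (by simp [PreTy.comps])
  | inter _ _ ih₁ ih₂ => exact ih₁.append ih₂
  | arrow hU hT => exact .arrow hU hT
  | exp i _ ih => exact ih.map_cons i

theorem TyEq.homogeneous {U V : PreTy} (h : TyEq U V) :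
    (U.Homogeneous ↔ V.Homogeneous) ∧ (U.Homogeneous → tdeg U = tdeg V) := by
  induction h <;> simp_all only [PreTy.Homogeneous, tdeg] <;> grind

theorem TySub.homogeneous {U V : PreTy} (h : TySub U V) (hU : U.Homogeneous) :
    V.Homogeneous ∧ tdeg U = tdeg V := by
  induction h with
  | ofEq h => exact ⟨h.homogeneous.1.1 hU, h.homogeneous.2 hU⟩
  | _ => simp_all [PreTy.Homogeneous, tdeg]

theorem PreTy.Homogeneous.fst_eq_tdeg {U : PreTy} (hU : U.Homogeneous) :
    ∀ c ∈ U.comps, c.1 = tdeg U := by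
  induction U with
  | atom => simp [comps, tdeg]
  | arrow => simp [comps, tdeg]
  | omega => simp [comps]
  | inter U V ihU ihV =>
    intro c hc
    rcases List.mem_append.1 hc with hc | hc
    · exact ihU hU.1 c hc
    · exact (ihV hU.2.1 c hc).trans hU.2.2.symm
  | exp i U ih =>
    intro c hc
    obtain ⟨d, hd, rfl⟩ := List.mem_map.1 hc
    simp [tdeg, ih hU d hd]

/-- Right-nested intersection ending in `ω^K`. -/
def interOmega (K : List ℕ) (l : List PreTy) : PreTy := l.foldr .inter (.omega K)

theorem tdeg_interOmega {K : List ℕ} {l : List PreTy} (h : ∀ U ∈ l, tdeg U = K) :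
    tdeg (interOmega K l) = K := by
  cases l with
  | nil => rfl
  | cons U l => exact h U (by simp)

theorem TyEq.inter_omega {K : List ℕ} {U : PreTy} (h : tdeg U = K) :
    TyEq (.inter U (.omega K)) U :=
  (TyEq.interComm _ _).trans (.omegaNeutral h)

theorem interOmega_append {K : List ℕ} {l l' : List PreTy} (h' : ∀ U ∈ l', tdeg U = K) :
    TyEq (.inter (interOmega K l) (interOmega K l')) (interOmega K (l ++ l')) := by
  induction l with
  | nil => exact .omegaNeutral (tdeg_interOmega h')
  | cons U l ih => exact (TyEq.interAssoc _ _ _).symm.trans (.interCongr (.refl U) ih)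

theorem exp_interOmega (i : ℕ) (K : List ℕ) (l : List PreTy) :
    TyEq (.exp i (interOmega K l)) (interOmega (i :: K) (l.map (.exp i))) := by
  induction l with
  | nil => exact .expOmega i K
  | cons U l ih => exact (TyEq.expDist i _ _).trans (.interCongr (.refl _) ih)

theorem foldl_inter {K : List ℕ} (l : List PreTy) {U : PreTy} (h : tdeg U = K) :
    TyEq (.inter U (interOmega K l)) (l.foldl .inter U) := by
  induction l generalizing U with
  | nil => exact .inter_omega h
  | cons V l ih => exact (TyEq.interAssoc _ _ _).trans (ih (U := .inter U V) h)

theorem interOmega_eq_interAll {K : List ℕ} {l : List PreTy} (hne : l ≠ [])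
    (h : ∀ U ∈ l, tdeg U = K) : TyEq (interOmega K l) (interAll l) := by
  cases l with
  | nil => exact absurd rfl hne
  | cons U l => exact foldl_inter l (h U (by simp))

theorem PreTy.tdeg_expSeq_comps {U : PreTy} : ∀ c ∈ U.comps, tdeg (expSeq c.1 c.2) = c.1 := by
  induction U with
  | atom => simp [comps, tdeg, expSeq]
  | arrow => simp [comps, tdeg, expSeq]
  | omega => simp [comps]
  | inter U V ihU ihV =>
    intro c hc
    rcases List.mem_append.1 hc with hc | hc
    exacts [ihU c hc, ihV c hc]
  | exp i U ih =>
    intro c hc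
    obtain ⟨d, hd, rfl⟩ := List.mem_map.1 hc
    simp [tdeg, expSeq, ih d hd]

theorem PreTy.Homogeneous.tdeg_of_mem {U : PreTy} (hU : U.Homogeneous) :
    ∀ V ∈ U.comps.map (fun c => expSeq c.1 c.2), tdeg V = tdeg U := by
  intro V hV
  obtain ⟨c, hc, rfl⟩ := List.mem_map.1 hV
  rw [tdeg_expSeq_comps c hc, hU.fst_eq_tdeg c hc]

theorem PreTy.Homogeneous.eq_interOmega {U : PreTy} (hU : U.Homogeneous) :
    TyEq U (interOmega (tdeg U) (U.comps.map fun c => expSeq c.1 c.2)) := by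
  induction U with
  | atom => exact (TyEq.inter_omega rfl).symm
  | arrow => exact (TyEq.inter_omega rfl).symm
  | omega => exact .refl _
  | inter U V ihU ihV =>
    obtain ⟨hU, hV, hd⟩ := hU
    have h := interOmega_append (l := U.comps.map fun c => expSeq c.1 c.2) hV.tdeg_of_mem
    rw [← hd] at h
    rw [comps, List.map_append]
    exact ((ihU hU).interCongr (hd ▸ ihV hV)).trans h
  | exp i U ih =>
    have h := ((ih hU).expCongr i).trans (exp_interOmega _ _ _)
    simpa [comps, tdeg, Function.comp_def, expSeq] using h

theorem Trm.mem_fv_lift {j : ℕ} {M : Trm} {x : ℕ} {L : List ℕ} :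
    (x, L) ∈ fv (lift j M) ↔ ∃ L', L = j :: L' ∧ (x, L') ∈ fv M := by
  induction M with
  | var y K => simp [lift, fv]; grind
  | app M N ihM ihN => simp [lift, fv, ihM, ihN]; grind
  | lam y K M ih => simp [lift, fv, ih]; grind

theorem Trm.deg_lift (j : ℕ) (M : Trm) : deg (lift j M) = j :: deg M := by
  induction M <;> simp_all [lift, deg]

theorem Typ.dom_eq {M : Trm} {Γ : TyEnv} {U : PreTy} (h : Typ M Γ U) (x : ℕ) (L : List ℕ) :
    Γ (x, L) = none ↔ (x, L) ∉ fv M := by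
  induction h generalizing x L with
  | ax => simp [TyEnv.single, fv]
  | omegaI => simp [TyEnv.omegaOf]
  | @arrI M Γ y K U T hn _ _ _ ih =>
    have := ih x L
    simp only [TyEnv.extend, fv] at *
    grind
  | @arrI' M Γ y K T hn _ _ ih =>
    have := ih x L
    simp only [fv] at *
    grind
  | arrE _ _ _ _ _ ih₁ ih₂ =>
    have h₁ := ih₁ x L
    have h₂ := ih₂ x L
    simp only [TyEnv.inter, fv] at *
    grind
  | interI _ _ ih => exact ih x L
  | expI j _ ih =>
    rw [mem_fv_lift]
    cases L with
    | nil => simp [TyEnv.expand]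
    | cons i L =>
      have := ih x L
      by_cases hij : i = j <;> simp [TyEnv.expand, hij, this]
  | sub _ hΓ _ ih => exact (hΓ.1 _).trans (ih x L)

theorem TyT.homogeneous {T : PreTy} (h : TyT T) : T.Homogeneous ∧ tdeg T = [] := by
  cases h <;> simp [PreTy.Homogeneous, tdeg]

theorem Typ.homogeneous {M : Trm} {Γ : TyEnv} {U : PreTy} (h : Typ M Γ U) :
    U.Homogeneous ∧ tdeg U = deg M := by
  induction h with
  | ax hT => exact hT.homogeneous
  | omegaI => simp [PreTy.Homogeneous, tdeg]
  | arrI _ _ hT _ ih =>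
    exact ⟨trivial, by rw [deg, ← ih.2, hT.homogeneous.2, tdeg]⟩
  | arrI' _ hT _ ih =>
    exact ⟨trivial, by rw [deg, ← ih.2, hT.homogeneous.2, tdeg]⟩
  | arrE _ hT _ _ _ ih₁ =>
    exact ⟨hT.homogeneous.1, by rw [deg, ← ih₁.2, hT.homogeneous.2, tdeg]⟩
  | interI _ _ ih₁ ih₂ => exact ⟨⟨ih₁.1, ih₂.1, ih₁.2.trans ih₂.2.symm⟩, ih₁.2⟩
  | expI j _ ih => exact ⟨ih.1, by rw [deg_lift, tdeg, ih.2]⟩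
  | sub _ _ hU ih =>
    have h := hU.homogeneous ih.1
    exact ⟨h.1, h.2.symm.trans ih.2⟩

theorem TySub.expSeq (K : List ℕ) {U V : PreTy} (h : TySub U V) :
    TySub (expSeq K U) (expSeq K V) := by
  induction K with
  | nil => exact h
  | cons i K ih => exact .exp i ih

theorem TyEnv.Sub.extend {Γ Γ' : TyEnv} (h : Sub Γ Γ') (v : IVar) {U U' : PreTy}
    (hU : TySub U U') : Sub (Γ.extend v U) (Γ'.extend v U') := by
  refine ⟨fun w => ?_, fun w V V' hV hV' => ?_⟩
  · have := h.1 w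
    simp only [TyEnv.extend]
    grind
  · have := h.2 w V V'
    simp only [TyEnv.extend] at hV hV'
    grind

theorem TyEnv.expand_extend (j : ℕ) (Γ : TyEnv) (x : ℕ) (L : List ℕ) (U : PreTy) :
    expand j (Γ.extend (x, L) U) = (expand j Γ).extend (x, j :: L) (.exp j U) := by
  funext ⟨y, K⟩
  cases K <;> simp only [expand, extend] <;> grind

/-- Each component `(K, A)` of a type of `λx^L.M` is an arrow `V → T`, and `M` has the
type `e⃗_K T` that this arrow calls for. -/
theorem Typ.lam_comps {N : Trm} {Γ : TyEnv} {U : PreTy} (h : Typ N Γ U) {x : ℕ} {L : List ℕ}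
    {M : Trm} (hN : N = .lam x L M) :
    ∀ c ∈ U.comps, ∃ V T, c.2 = .arrow V T ∧
      ((x, L) ∈ fv M → Typ M (Γ.extend (x, L) (expSeq c.1 V)) (expSeq c.1 T)) ∧
      ((x, L) ∉ fv M → Typ M Γ (expSeq c.1 T)) := by
  induction h generalizing x L M with
  | ax => cases hN
  | omegaI => simp [PreTy.comps]
  | @arrI M' Γ y K V T _ _ _ hM =>
    obtain ⟨rfl, rfl, rfl⟩ := Trm.lam.inj hN
    have hx : (y, K) ∈ fv M' := by
      by_contra hx
      simpa [TyEnv.extend] using (hM.dom_eq y K).2 hx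
    simpa [PreTy.comps, expSeq, hx] using hM
  | @arrI' M' Γ y K T hn _ hM =>
    obtain ⟨rfl, rfl, rfl⟩ := Trm.lam.inj hN
    have hx := (hM.dom_eq y K).1 hn
    simpa [PreTy.comps, expSeq, hx] using hM
  | arrE => cases hN
  | interI _ _ ih₁ ih₂ =>
    intro c hc
    rcases List.mem_append.1 hc with hc | hc
    exacts [ih₁ hN c hc, ih₂ hN c hc]
  | @expI M' Γ U j _ ih =>
    cases M' with
    | var | app => cases hN
    | lam y K M' =>
      obtain ⟨rfl, rfl, rfl⟩ := Trm.lam.inj hN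
      intro c hc
      obtain ⟨d, hd, rfl⟩ := List.mem_map.1 hc
      obtain ⟨V, T, hVT, h₁, h₂⟩ := ih rfl d hd
      have hfv : (y, j :: K) ∈ fv (lift j M') ↔ (y, K) ∈ fv M' := by simp [mem_fv_lift]
      rw [hfv]
      refine ⟨V, T, hVT, fun hx => ?_, fun hx => (h₂ hx).expI j⟩
      have := (h₁ hx).expI j
      rwa [TyEnv.expand_extend] at this
  | sub _ hΓ hU ih =>
    intro c hc
    obtain ⟨d, hd, hdc⟩ := hU.compsSub c hc
    obtain ⟨V, T, hVT, h₁, h₂⟩ := ih hN d hd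
    cases hdc with
    | atom => cases hVT
    | arrow K hV hT =>
      cases hVT
      exact ⟨_, _, rfl, fun hx => (h₁ hx).sub (hΓ.extend _ (hV.expSeq K)) (hT.expSeq K),
        fun hx => (h₂ hx).sub hΓ (hT.expSeq K)⟩

/-- generation for abstractions. -/
theorem stmt9 (x : ℕ) (L : List ℕ) (M : Trm) (Γ : TyEnv) (U : PreTy) (K : List ℕ)
    (h : Typ (.lam x L M) Γ U) (hd : tdeg U = K) :
    TyEq U (.omega K) ∨
    ∃ ps : List (PreTy × PreTy), ps ≠ [] ∧
      TyEq U (interAll (ps.map fun p => expSeq K (.arrow p.1 p.2))) ∧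
      ((x, L) ∈ Trm.fv M →
        ∀ p ∈ ps, Typ M (Γ.extend (x, L) (expSeq K p.1)) (expSeq K p.2)) ∧
      ((x, L) ∉ Trm.fv M →
        ∀ p ∈ ps, Typ M Γ (expSeq K p.2)) := by
  subst hd
  have hU := h.homogeneous.1
  have hrep := hU.eq_interOmega
  by_cases hne : U.comps = []
  · rw [hne] at hrep
    exact .inl hrep
  right
  have hcomps : ∀ c ∈ U.comps, ∃ p : PreTy × PreTy, (tdeg U, PreTy.arrow p.1 p.2) = c := by
    intro c hc
    obtain ⟨V, T, hVT, -⟩ := h.lam_comps rfl c hc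
    exact ⟨(V, T), Prod.ext (hU.fst_eq_tdeg c hc).symm hVT.symm⟩
  obtain ⟨ps, hps⟩ : U.comps ∈ Set.range (List.map fun p : PreTy × PreTy =>
      (tdeg U, PreTy.arrow p.1 p.2)) := by
    rw [Set.range_list_map]
    exact hcomps
  have hM : ∀ p ∈ ps,
      ((x, L) ∈ fv M →
        Typ M (Γ.extend (x, L) (expSeq (tdeg U) p.1)) (expSeq (tdeg U) p.2)) ∧
      ((x, L) ∉ fv M → Typ M Γ (expSeq (tdeg U) p.2)) := by
    intro p hp
    obtain ⟨V, T, hVT, hVT'⟩ := h.lam_comps rfl (tdeg U, .arrow p.1 p.2)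
      (hps ▸ List.mem_map_of_mem hp)
    cases hVT
    exact hVT'
  refine ⟨ps, ?_, ?_, fun hx p hp => (hM p hp).1 hx, fun hx p hp => (hM p hp).2 hx⟩
  · rintro rfl
    exact hne hps.symm
  · have := hrep.trans (interOmega_eq_interAll (by simpa using hne) hU.tdeg_of_mem)
    rwa [← hps, List.map_map] at this
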